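/- (Theorem II) Let n > 0 be real, let p and q be positive real numbers, set f = √(p² + q²) and θ = arctan(q/p). Then the integral of x^(n-1)·e^(-px)·sin(qx) over x from 0 to infinity equals Γ(n)·sin(nθ)/f^n. -/

import Mathlib

open MeasureTheory ProbabilityTheory Set Filter Topology

/-- The measure on `ℝ` with density `x ^ s` on the positive half-line. -/
noncomputable def rpowMeasure (s : ℝ) : Measure ℝ :=
  (volume.restrict (Ioi 0)).withDensity fun x ↦ ((x ^ s).toNNReal : ENNReal)

lemma measurable_toNNReal_rpow (s : ℝ) : Measurable fun x : ℝ ↦ (x ^ s).toNNReal := by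
  fun_prop

lemma integrable_rpowMeasure_iff {E : Type*} [NormedAddCommGroup E] [NormedSpace ℝ E] (s : ℝ)
    (g : ℝ → E) : Integrable g (rpowMeasure s) ↔ IntegrableOn (fun x ↦ x ^ s • g x) (Ioi 0) := by
  rw [rpowMeasure, integrable_withDensity_iff_integrable_smul (measurable_toNNReal_rpow s)]
  refine integrableOn_congr_fun (fun x hx ↦ ?_) measurableSet_Ioi
  simp only [NNReal.smul_def, Real.coe_toNNReal _ (Real.rpow_nonneg (le_of_lt hx) s)]

lemma integral_rpowMeasure {E : Type*} [NormedAddCommGroup E] [NormedSpace ℝ E] (s : ℝ)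
    (g : ℝ → E) : ∫ x, g x ∂rpowMeasure s = ∫ x in Ioi 0, x ^ s • g x := by
  rw [rpowMeasure, integral_withDensity_eq_integral_smul (measurable_toNNReal_rpow s)]
  refine setIntegral_congr_fun measurableSet_Ioi fun x hx ↦ ?_
  simp only [NNReal.smul_def, Real.coe_toNNReal _ (Real.rpow_nonneg (le_of_lt hx) s)]

lemma Iio_subset_integrableExpSet_rpowMeasure {s : ℝ} (hs : -1 < s) :
    Iio 0 ⊆ integrableExpSet id (rpowMeasure s) := by
  intro t ht
  rw [integrableExpSet, mem_ofPred_eq, integrable_rpowMeasure_iff]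
  simpa using integrableOn_rpow_mul_exp_neg_mul_rpow hs one_pos (neg_pos.2 ht)

lemma mgf_rpowMeasure {n t : ℝ} (hn : 0 < n) (ht : t < 0) :
    mgf id (rpowMeasure (n - 1)) t = Real.Gamma n * (-t) ^ (-n) := by
  have h := Real.integral_rpow_mul_exp_neg_mul_Ioi hn (neg_pos.2 ht)
  rw [one_div, Real.inv_rpow (neg_pos.2 ht).le, ← Real.rpow_neg (neg_pos.2 ht).le, mul_comm] at h
  rw [mgf, integral_rpowMeasure, ← h]
  simp

lemma complexMGF_rpowMeasure {n : ℝ} (hn : 0 < n) {z : ℂ} (hz : z.re < 0) :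
    complexMGF id (rpowMeasure (n - 1)) z = Real.Gamma n * (-z) ^ (-n : ℂ) := by
  have hconn : IsPreconnected {z : ℂ | z.re < 0} :=
    (convex_halfSpace_re_lt 0).isPreconnected
  have hopen : IsOpen {z : ℂ | z.re < 0} := isOpen_lt Complex.continuous_re continuous_const
  have hsub := interior_maximal
    (Iio_subset_integrableExpSet_rpowMeasure (by linarith : -1 < n - 1)) isOpen_Iio
  have hf : AnalyticOnNhd ℂ (complexMGF id (rpowMeasure (n - 1))) {z | z.re < 0} :=
    fun w hw ↦ analyticAt_complexMGF (hsub hw)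
  have hg : AnalyticOnNhd ℂ (fun w : ℂ ↦ Real.Gamma n * (-w) ^ (-n : ℂ)) {z | z.re < 0} := by
    refine DifferentiableOn.analyticOnNhd (fun w hw ↦ ?_) hopen
    have hw' : -w ∈ Complex.slitPlane := Or.inl (by simpa using hw)
    exact ((differentiableAt_id.neg.cpow_const hw').const_mul _).differentiableWithinAt
  refine hf.eqOn_of_preconnected_of_frequently_eq hg hconn (z₀ := ((-1 : ℝ) : ℂ)) (by simp) ?_ hz
  have htend : Tendsto (fun x : ℝ ↦ (x : ℂ)) (𝓝[≠] (-1)) (𝓝[≠] ((-1 : ℝ) : ℂ)) :=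
    Complex.continuous_ofReal.continuousAt.continuousWithinAt.tendsto_nhdsWithin
      fun x hx ↦ by simpa using fun h ↦ hx (by exact_mod_cast h)
  refine htend.frequently (Eventually.frequently ?_)
  filter_upwards [nhdsWithin_le_nhds (Iio_mem_nhds (by norm_num : (-1 : ℝ) < 0))] with x hx
  rw [complexMGF_ofReal, mgf_rpowMeasure hn hx, Complex.ofReal_mul,
    Complex.ofReal_cpow (neg_pos.2 hx).le]
  simp

lemma Complex.arg_eq_arctan_of_re_pos {z : ℂ} (hz : 0 < z.re) :
    z.arg = Real.arctan (z.im / z.re) := by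
  have h := abs_lt.1 (Complex.abs_arg_lt_pi_div_two_iff.2 (Or.inl hz))
  rw [← Complex.tan_arg, Real.arctan_tan h.1 h.2]

theorem integral_rpow_mul_exp_neg_mul_sin (n p q : ℝ) (hn : 0 < n) (hp : 0 < p) (hq : 0 < q) :
    ∫ x in Set.Ioi (0:ℝ), x ^ (n - 1) * Real.exp (-(p * x)) * Real.sin (q * x) =
      Real.Gamma n * Real.sin (n * Real.arctan (q / p)) / Real.sqrt (p ^ 2 + q ^ 2) ^ n := by
  set z : ℂ := ⟨-p, q⟩ with hz
  have hre : z.re < 0 := neg_neg_iff_pos.2 hp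
  have hint : Integrable (fun x : ℝ ↦ Complex.exp (z * x)) (rpowMeasure (n - 1)) := by
    have h := Iio_subset_integrableExpSet_rpowMeasure (by linarith : -1 < n - 1) hre
    rw [← integrable_norm_iff (by fun_prop)]
    simpa [Complex.norm_exp, integrableExpSet] using h
  have him := integral_im hint
  rw [integral_rpowMeasure] at him
  have hcm : ∫ x : ℝ, Complex.exp (z * x) ∂rpowMeasure (n - 1) =
      Real.Gamma n * (-z) ^ (-n : ℂ) := complexMGF_rpowMeasure hn hre
  have harg : (-z).arg = -Real.arctan (q / p) := by
    rw [Complex.arg_eq_arctan_of_re_pos (by simpa using hre)]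
    simp [hz, neg_div, Real.arctan_neg]
  have hnorm : ‖-z‖ = √(p ^ 2 + q ^ 2) := by
    rw [norm_neg, Complex.norm_def, Complex.normSq_apply]
    simp [hz, sq]
  calc
    _ = ∫ x in Ioi (0 : ℝ), x ^ (n - 1) • RCLike.im (Complex.exp (z * x)) := by
      simp [Complex.exp_im, hz, mul_assoc]
    _ = (Real.Gamma n * (-z) ^ (-n : ℂ)).im := by rw [him, hcm]; rfl
    _ = _ := by
      rw [Complex.im_ofReal_mul, ← Complex.ofReal_neg, Complex.cpow_ofReal_im, hnorm, harg,
        Real.rpow_neg (Real.sqrt_nonneg _), neg_mul_neg, mul_comm (Real.arctan _)]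
      ring
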